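/- arXiv:1402.2367 — 2 statements merged into one kernel-verified Lean document; each statement's English description precedes it below -/
import Mathlib

section
/- For all positive integers n and k with 1 ≤ k ≤ n and all real x > 0, the sum ∑_{k=1}^{n} L(n,k) x^k equals (e^{-x}/x^n) ∫_0^∞ (∑_{j=0}^∞ t^j/(j!(j+1)!)) t^n e^{-t/x} dt, where the series ∑_{j=0}^∞ t^j/(j!(j+1)!) equals I_1(2√t)/√t with I_1 the modified Bessel function of the first kind. -/
open MeasureTheory Real Finset

/-- Lah numbers: `L(n,k) = C(n-1,k-1) * n! / k!` (as a real number). -/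
noncomputable def lah (n k : ℕ) : ℝ :=
  ((n - 1).choose (k - 1) : ℝ) * (Nat.factorial n) / (Nat.factorial k)

lemma lah_aux_choose (m k : ℕ) :
    (m + k).choose k * m.factorial * k.factorial = (m + k).factorial := by
  have h := Nat.choose_mul_factorial_mul_factorial (Nat.le_add_left k m)
  rw [Nat.add_sub_cancel] at h
  rw [← h]
  ring

lemma lah_aux_exp (x : ℝ) (k : ℕ) :
    HasSum (fun m : ℕ => (m.choose k : ℝ) * x ^ m / (m.factorial : ℝ))
      (Real.exp x * (x ^ k / (k.factorial : ℝ))) := by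
  have hinj : Function.Injective (fun m : ℕ => m + k) := add_left_injective k
  rw [← hinj.hasSum_iff]
  · have h : HasSum (fun m : ℕ => x ^ m / (m.factorial : ℝ)) (Real.exp x) := by
      rw [Real.exp_eq_exp_ℝ]
      exact NormedSpace.expSeries_div_hasSum_exp x
    convert h.mul_right (x ^ k / (k.factorial : ℝ)) using 1
    · rfl
    funext m
    have h1 : ((m + k).choose k : ℝ) * (m.factorial : ℝ) * (k.factorial : ℝ)
        = ((m + k).factorial : ℝ) := by
      exact_mod_cast lah_aux_choose m k
    simp only [Function.comp]
    rw [← h1]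
    have h2 : ((m + k).choose k : ℝ) ≠ 0 := by
      exact_mod_cast (Nat.choose_pos (Nat.le_add_left k m)).ne'
    have := Nat.factorial_ne_zero m
    have := Nat.factorial_ne_zero k
    field_simp
    ring
  · intro m hm
    have : m < k := by
      by_contra hc
      exact hm ⟨m - k, by simp only; omega⟩
    simp [Nat.choose_eq_zero_of_lt this]

lemma lah_aux_vandermonde (n m : ℕ) (hn : 1 ≤ n) :
    ∑ k ∈ Finset.Icc 1 n, (n - 1).choose (k - 1) * m.choose k = (m + (n - 1)).choose n := by
  rw [Nat.add_choose_eq, Finset.Nat.sum_antidiagonal_eq_sum_range_succ_mk,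
    Finset.sum_range_succ']
  simp only [Nat.sub_zero]
  rw [Nat.choose_eq_zero_of_lt (show n - 1 < n by omega), mul_zero, add_zero]
  rw [Finset.range_eq_Ico, Finset.sum_Ico_add' (fun k => m.choose k * (n-1).choose (n - k)) 0 n 1]
  apply Finset.sum_congr
  · ext a; simp
  · intro k hk
    simp only [Finset.mem_Ico] at hk
    rw [mul_comm, ← Nat.choose_symm (show k - 1 ≤ n - 1 by omega)]
    congr 2
    omega

lemma lah_aux_sum (n : ℕ) (hn : 1 ≤ n) (x : ℝ) :
    HasSum (fun j : ℕ => ((n + j).factorial : ℝ) * x ^ (j + 1)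
        / ((j.factorial : ℝ) * ((j + 1).factorial : ℝ)))
      (Real.exp x * ∑ k ∈ Finset.Icc 1 n, lah n k * x ^ k) := by
  have h : HasSum (fun m : ℕ => ∑ k ∈ Finset.Icc 1 n,
      ((n - 1).choose (k - 1) * n.factorial : ℝ) * ((m.choose k : ℝ) * x ^ m / (m.factorial : ℝ)))
      (∑ k ∈ Finset.Icc 1 n, ((n - 1).choose (k - 1) * n.factorial : ℝ) *
        (Real.exp x * (x ^ k / (k.factorial : ℝ)))) :=
    hasSum_sum fun k _ => (lah_aux_exp x k).mul_left _
  have e : (fun m : ℕ => ∑ k ∈ Finset.Icc 1 n,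
      ((n - 1).choose (k - 1) * n.factorial : ℝ) * ((m.choose k : ℝ) * x ^ m / (m.factorial : ℝ)))
      = fun m : ℕ => ((m + (n - 1)).choose n : ℝ) * n.factorial * x ^ m / m.factorial := by
    funext m
    rw [← lah_aux_vandermonde n m hn]
    push_cast
    simp only [Finset.sum_mul, Finset.sum_div]
    refine Finset.sum_congr rfl fun k _ => ?_
    ring
  rw [e, ← hasSum_nat_add_iff' 1] at h
  convert h using 1
  · rfl
  · funext j
    have e1 : j + 1 + (n - 1) = j + n := by omega
    have h1 : ((j + n).choose n : ℝ) * (j.factorial : ℝ) * (n.factorial : ℝ)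
        = ((j + n).factorial : ℝ) := by
      exact_mod_cast lah_aux_choose j n
    rw [e1, add_comm n j, ← h1]
    have := Nat.factorial_ne_zero j
    have := Nat.factorial_ne_zero (j + 1)
    field_simp
  · simp [Nat.choose_eq_zero_of_lt (show n - 1 < n by omega), Finset.mul_sum, lah]
    refine Finset.sum_congr rfl fun k _ => ?_
    ring

lemma lah_aux_int (m : ℕ) (x : ℝ) (hx : 0 < x) :
    ∫ t in Set.Ioi (0 : ℝ), t ^ m * Real.exp (-t / x) = (m.factorial : ℝ) * x ^ (m + 1) := by
  have h := Real.integral_rpow_mul_exp_neg_mul_Ioi (a := (m : ℝ) + 1) (r := 1 / x)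
    (by positivity) (by positivity)
  rw [Real.Gamma_nat_eq_factorial] at h
  have h3 : (1 / (1 / x)) ^ ((m : ℝ) + 1) = x ^ (m + 1) := by
    rw [one_div_one_div]; exact_mod_cast Real.rpow_natCast x (m + 1)
  rw [h3, mul_comm] at h
  rw [← h]
  refine setIntegral_congr_fun measurableSet_Ioi fun t _ => ?_
  simp only [add_sub_cancel_right, Real.rpow_natCast]
  congr 2
  ring

theorem lah_sum_integral_repr (n : ℕ) (hn : 1 ≤ n) (x : ℝ) (hx : 0 < x) :
    ∑ k ∈ Finset.Icc 1 n, lah n k * x ^ k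
      = (Real.exp (-x) / x ^ n) *
        ∫ t in Set.Ioi (0 : ℝ),
          (∑' j : ℕ, t ^ j / ((Nat.factorial j : ℝ) * (Nat.factorial (j + 1))))
            * t ^ n * Real.exp (-t / x) := by
  set F : ℕ → ℝ → ℝ := fun j t =>
    (t ^ (n + j) * Real.exp (-t / x)) / ((Nat.factorial j : ℝ) * (Nat.factorial (j + 1))) with hF
  have hI : ∀ j, ∫ t in Set.Ioi (0 : ℝ), F j t =
      x ^ n * (((n + j).factorial : ℝ) * x ^ (j + 1)
        / ((j.factorial : ℝ) * ((j + 1).factorial : ℝ))) := by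
    intro j
    simp only [hF]
    rw [integral_div, lah_aux_int _ _ hx]
    ring
  have hsum := (lah_aux_sum n hn x).mul_left (x ^ n)
  have hint : ∀ j, Integrable (F j) (volume.restrict (Set.Ioi 0)) := by
    intro j
    apply Integrable.of_integral_ne_zero
    rw [hI]
    positivity
  have key := hasSum_integral_of_summable_integral_norm hint (by
    have e : (fun j => ∫ t in Set.Ioi (0 : ℝ), ‖F j t‖) =
        fun j => x ^ n * (((n + j).factorial : ℝ) * x ^ (j + 1)
        / ((j.factorial : ℝ) * ((j + 1).factorial : ℝ))) := by
      funext j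
      rw [← hI]
      refine setIntegral_congr_fun measurableSet_Ioi fun t ht => ?_
      have ht' : (0 : ℝ) < t := ht
      exact Real.norm_of_nonneg (by simp only [hF]; positivity)
    rw [e]
    exact hsum.summable)
  simp only [hI] at key
  have e2 : ∫ t in Set.Ioi (0 : ℝ),
          (∑' j : ℕ, t ^ j / ((Nat.factorial j : ℝ) * (Nat.factorial (j + 1))))
            * t ^ n * Real.exp (-t / x) = ∫ t in Set.Ioi (0 : ℝ), ∑' j, F j t := by
    congr 1
    funext t
    rw [mul_assoc, ← tsum_mul_right]
    refine tsum_congr fun j => ?_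
    simp only [hF]
    ring
  rw [e2, key.unique hsum, Real.exp_neg]
  have := Real.exp_ne_zero x
  field_simp
end

section
/- For all positive integers m and n with 1 ≤ n ≤ m, the Lah number L(m,n) equals the associated Lah number with parameter k = 1: L(m,n) = (m!/n!) ∑_{r=1}^{n} (-1)^{n-r} C(n, r) C(m+r-1, m). -/
open Finset

/-- `L(m,n) = L_1(m,n)`: the Lah number coincides with the associated Lah number of
parameter `k = 1`. -/
theorem lah_eq_associated_lah_one (m n : ℕ) (hn : 1 ≤ n) (hnm : n ≤ m) :
    lah m n
      = ((Nat.factorial m : ℝ) / (Nat.factorial n : ℝ)) *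
        ∑ r ∈ Finset.Icc 1 n, (-1 : ℝ) ^ (n - r) * (n.choose r : ℝ) *
          ((m + r - 1).choose m : ℝ) := by
  have h1 := fwdDiff_iter_eq_sum_shift (1 : ℕ) (fun x ↦ x.choose (n + (m - n)) : ℕ → ℤ) n (m - 1)
  rw [fwdDiff_iter_choose, Nat.add_sub_cancel' hnm] at h1
  have hs : (m - 1).choose (m - n) = (m - 1).choose (n - 1) := by
    rw [← Nat.choose_symm (show n - 1 ≤ m - 1 by omega)]
    congr 1
    omega
  simp only [hs] at h1
  have h2 := congrArg (Int.cast : ℤ → ℝ) h1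
  rw [Finset.sum_range_succ'] at h2
  have h0 : (m - 1).choose m = 0 := Nat.choose_eq_zero_of_lt (by omega)
  simp [h0] at h2
  have h3 : ∑ r ∈ Finset.Icc 1 n, (-1 : ℝ) ^ (n - r) * (n.choose r : ℝ) *
      ((m + r - 1).choose m : ℝ) = ((m - 1).choose (n - 1) : ℝ) := by
    rw [h2, ← Finset.Ico_add_one_right_eq_Icc, Finset.sum_Ico_eq_sum_range]
    refine Finset.sum_congr (by simp) fun k _ => ?_
    rw [show m + (1 + k) - 1 = m - 1 + (k + 1) by omega, add_comm 1 k]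
  rw [h3, lah]
  ring
end
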